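/- For every unsatisfiable r-CNF formula φ, Space(φ) ≥ Deg(φ) − r − 1, where Space is the Res(⊕) clause space of φ and Deg is the minimum degree of a Polynomial Calculus refutation of the arithmetization of φ over 𝔽₂. -/

import Mathlib

open Finset

/-- The two-element field. -/
abbrev F2 : Type := ZMod 2

/-- An `F2`-linear form in the variables `V`, given by its coefficients. -/
abbrev LinForm (V : Type) : Type := V → F2

/-- A linear literal: an equation `f = a` where `f` is a linear form and `a ∈ F2`. -/
abbrev LinLit (V : Type) : Type := LinForm V × F2

/-- A linear clause: a finite disjunction of linear literals. -/
abbrev LinClause (V : Type) : Type := Finset (LinLit V)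

/-- A linear system: a finite conjunction of linear equations. -/
abbrev LinSystem (V : Type) : Type := Finset (LinLit V)

/-- A linear CNF formula: a conjunction of linear clauses. -/
abbrev LinCNF (V : Type) : Type := Set (LinClause V)

variable {V : Type}

/-- Evaluation of a linear form at an assignment. -/
def evalForm [Fintype V] (f : LinForm V) (σ : V → F2) : F2 := ∑ v, f v * σ v

/-- The assignment `σ` satisfies the linear equation `l.1 = l.2`. -/
def LitSat [Fintype V] (σ : V → F2) (l : LinLit V) : Prop := evalForm l.1 σ = l.2

/-- The assignment `σ` satisfies the linear clause `C` (some literal of `C` holds). -/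
def ClauseSat [Fintype V] (σ : V → F2) (C : LinClause V) : Prop := ∃ l ∈ C, LitSat σ l

/-- The assignment `σ` is a solution of the linear system `S` (all equations hold). -/
def SysSat [Fintype V] (σ : V → F2) (S : LinSystem V) : Prop := ∀ l ∈ S, LitSat σ l

/-- The assignment `σ` satisfies the linear CNF `φ`. -/
def CNFSat [Fintype V] (σ : V → F2) (φ : LinCNF V) : Prop := ∀ C ∈ φ, ClauseSat σ C

/-- The linear CNF `φ` is unsatisfiable. -/
def Unsat [Fintype V] (φ : LinCNF V) : Prop := ¬ ∃ σ, CNFSat σ φ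

/-- The positive literal `v = 1` for a single variable `v`. -/
def posLit [DecidableEq V] (v : V) : LinLit V := (Pi.single v 1, 1)

/-- The negative literal `v = 0` for a single variable `v`. -/
def negLit [DecidableEq V] (v : V) : LinLit V := (Pi.single v 1, 0)

/-- A solution is `F`-proper if it satisfies every clause of `F`. -/
def FProper [Fintype V] (F : Set (LinClause V)) (σ : V → F2) : Prop := ∀ C ∈ F, ClauseSat σ C

/-- `φ` is `m`-extensible w.r.t. `F`: every linear system with fewer than `m` equations
that has an `F`-proper solution has, for each clause `C ∈ φ \ F`, an `F`-proper solution
satisfying `C`. -/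
def Extensible [Fintype V] (φ : LinCNF V) (F : Set (LinClause V)) (m : ℕ) : Prop :=
  ∀ S : LinSystem V, S.card < m → (∃ σ, SysSat σ S ∧ FProper F σ) →
    ∀ C ∈ φ \ F, ∃ τ, SysSat τ S ∧ FProper F τ ∧ ClauseSat τ C

/-- A configuration: a finite set of linear clauses kept in memory. -/
abbrev Config (V : Type) : Type := Finset (LinClause V)

/-- Semantic inference: `C` follows from clauses in `S` by the resolution rule or the
semantic weakening rule. -/
def InferSem [Fintype V] [DecidableEq V] (S : Config V) (C : LinClause V) : Prop :=
  (∃ (f : LinForm V) (A B : LinClause V),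
      insert (f, (0 : F2)) A ∈ S ∧ insert (f, (1 : F2)) B ∈ S ∧ C = A ∪ B) ∨
  (∃ D ∈ S, ∀ σ, ClauseSat σ D → ClauseSat σ C)

/-- The identically zero linear form. -/
def zeroForm (V : Type) : LinForm V := fun _ => 0

/-- Syntactic inference: `C` follows from clauses in `S` by the resolution rule,
the simplification rule, the syntactic weakening rule, or the addition rule. -/
def InferSyn [Fintype V] [DecidableEq V] (S : Config V) (C : LinClause V) : Prop :=
  (∃ (f : LinForm V) (A B : LinClause V),
      insert (f, (0 : F2)) A ∈ S ∧ insert (f, (1 : F2)) B ∈ S ∧ C = A ∪ B) ∨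
  (insert ((zeroForm V, (1 : F2)) : LinLit V) C ∈ S) ∨
  (∃ (D : LinClause V) (f : LinForm V) (α : F2), D ∈ S ∧ C = insert (f, α) D) ∨
  (∃ (D : LinClause V) (f₁ f₂ : LinForm V) (α₁ α₂ : F2),
      insert (f₁, α₁) (insert (f₂, α₂) D) ∈ S ∧
      C = insert (f₁, α₁) (insert (f₁ + f₂, α₁ + α₂ + 1) D))

/-- One step of a configuration-style refutation: download a clause of `φ`,
erase a clause, or add a clause inferred (via `Inf`) from the current configuration. -/
inductive ConfigStep [Fintype V] [DecidableEq V] (φ : LinCNF V)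
    (Inf : Config V → LinClause V → Prop) : Config V → Config V → Prop
  | download {S : Config V} {C : LinClause V} (h : C ∈ φ) : ConfigStep φ Inf S (insert C S)
  | erase {S : Config V} {C : LinClause V} (h : C ∈ S) : ConfigStep φ Inf S (S.erase C)
  | infer {S : Config V} {C : LinClause V} (h : Inf S C) : ConfigStep φ Inf S (insert C S)

/-- A configuration-style Res(⊕) refutation of `φ` with inference rules `Inf`:
a sequence of configurations starting from the empty configuration, each obtained from
the previous one by a basic step, ending with a configuration containing the empty
clause. -/
def IsConfigRefutation [Fintype V] [DecidableEq V] (φ : LinCNF V)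
    (Inf : Config V → LinClause V → Prop) (π : List (Config V)) : Prop :=
  π.head? = some (∅ : Config V) ∧ List.Chain' (ConfigStep φ Inf) π ∧
    ∃ S : Config V, π.getLast? = some S ∧ (∅ : LinClause V) ∈ S

/-- The space of a sequence of configurations: the maximum number of clauses in memory. -/
def spaceOf (π : List (Config V)) : ℕ := (π.map Finset.card).foldr max 0

/-- Width-bounded Res(⊕) derivability: `ResLinW φ w C` holds if `C` has a Res(⊕)
derivation from the clauses of `φ` in which every clause has width at most `w`. -/
inductive ResLinW [Fintype V] [DecidableEq V] (φ : LinCNF V) (w : ℕ) : LinClause V → Prop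
  | ax {C : LinClause V} (hC : C ∈ φ) (hw : C.card ≤ w) : ResLinW φ w C
  | res {A B : LinClause V} {f : LinForm V}
      (h₁ : ResLinW φ w (insert (f, (0 : F2)) A)) (h₂ : ResLinW φ w (insert (f, (1 : F2)) B))
      (hw : (A ∪ B).card ≤ w) : ResLinW φ w (A ∪ B)
  | weak {C D : LinClause V} (h : ResLinW φ w C)
      (himp : ∀ σ, ClauseSat σ C → ClauseSat σ D) (hw : D.card ≤ w) : ResLinW φ w D

/-- `φ` has a Res(⊕) refutation of width at most `w`. -/
def WidthLE [Fintype V] [DecidableEq V] (φ : LinCNF V) (w : ℕ) : Prop :=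
  ResLinW φ w (∅ : LinClause V)

/-- `Space(φ)`: the minimum space of a configuration-style Res(⊕) refutation of `φ`. -/
noncomputable def SpaceOfCNF [Fintype V] [DecidableEq V] (φ : LinCNF V) : ℕ :=
  sInf {s | ∃ π : List (Config V), IsConfigRefutation φ InferSem π ∧ spaceOf π = s}

/-- `Width(φ)`: the minimum width of a Res(⊕) refutation of `φ`. -/
noncomputable def WidthOfCNF [Fintype V] [DecidableEq V] (φ : LinCNF V) : ℕ :=
  sInf {w | WidthLE φ w}

/-- An ordinary Boolean clause: a finite set of literals, each a variable with a polarity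
(`true` for the positive literal `x`, `false` for `¬x`). -/
abbrev BoolClause (V : Type) : Type := Finset (V × Bool)

/-- An ordinary CNF formula. -/
abbrev BoolCNF (V : Type) : Type := Set (BoolClause V)

/-- Translation of an ordinary clause into a linear clause: the literal `x` becomes the
equation `x = 1` and `¬x` becomes `x = 0`. -/
def toLinClause [Fintype V] [DecidableEq V] (C : BoolClause V) : LinClause V :=
  C.image fun l => if l.2 then posLit l.1 else negLit l.1

/-- Translation of an ordinary CNF into a linear CNF. -/
def toLinCNF [Fintype V] [DecidableEq V] (φ : BoolCNF V) : LinCNF V :=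
  {D | ∃ C ∈ φ, D = toLinClause C}

/-- Arithmetization of a clause: the product of the factors `1 - X v` for positive
literals `v` and `X v` for negative literals `¬v`. -/
noncomputable def clausePoly (C : BoolClause V) : MvPolynomial V F2 :=
  ∏ l ∈ C, (if l.2 then 1 - MvPolynomial.X l.1 else MvPolynomial.X l.1)

/-- The arithmetization of an ordinary CNF, as a set of polynomials over `F2`. -/
def arithSet (φ : BoolCNF V) : Set (MvPolynomial V F2) :=
  {p | ∃ C ∈ φ, p = clausePoly C}

/-- Degree-`d` Polynomial Calculus derivations over `F2` from the axioms `Ax`: one may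
download an axiom or a Boolean axiom `X v ^ 2 - X v`, take `F2`-linear combinations, and
multiply by a variable, with every derived polynomial of total degree at most `d`. -/
inductive PCDeriv (Ax : Set (MvPolynomial V F2)) (d : ℕ) : MvPolynomial V F2 → Prop
  | ax {p : MvPolynomial V F2} (hp : p ∈ Ax) (hd : p.totalDegree ≤ d) : PCDeriv Ax d p
  | boolAx (v : V)
      (hd : (MvPolynomial.X v ^ 2 - MvPolynomial.X v : MvPolynomial V F2).totalDegree ≤ d) :
      PCDeriv Ax d (MvPolynomial.X v ^ 2 - MvPolynomial.X v)
  | lin {p q : MvPolynomial V F2} (a b : F2) (hp : PCDeriv Ax d p) (hq : PCDeriv Ax d q)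
      (hd : (a • p + b • q).totalDegree ≤ d) : PCDeriv Ax d (a • p + b • q)
  | mul {p : MvPolynomial V F2} (v : V) (hp : PCDeriv Ax d p)
      (hd : (MvPolynomial.X v * p).totalDegree ≤ d) : PCDeriv Ax d (MvPolynomial.X v * p)

/-- `Deg(φ)`: the minimum degree of a `PC_{F2}` refutation of the arithmetization of the
ordinary CNF `φ`. -/
noncomputable def DegOfCNF [DecidableEq V] (φ : BoolCNF V) : ℕ :=
  sInf {d | PCDeriv (arithSet φ) d 1}

section Refutation

variable {Ax : Set (MvPolynomial V F2)} {d : ℕ}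

lemma card_le_spaceOf {π : List (Config V)} {S : Config V} (h : S ∈ π) : S.card ≤ spaceOf π := by
  induction π with
  | nil => simp at h
  | cons T π ih =>
    simp only [spaceOf, List.map_cons, List.foldr_cons] at ih ⊢
    rcases List.mem_cons.mp h with rfl | h
    · exact le_max_left _ _
    · exact (ih h).trans (le_max_right _ _)

lemma PCDeriv.totalDegree_le {p : MvPolynomial V F2} (h : PCDeriv Ax d p) : p.totalDegree ≤ d := by
  cases h <;> assumption

/-- The polynomials with a degree-`d` Polynomial Calculus derivation, together with `0`. -/
def pcSubmodule (Ax : Set (MvPolynomial V F2)) (d : ℕ) : Submodule F2 (MvPolynomial V F2) where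
  carrier := {p | p = 0 ∨ PCDeriv Ax d p}
  zero_mem' := Or.inl rfl
  add_mem' := by
    rintro p q (rfl | hp) (rfl | hq)
    · simp
    · simpa using Or.inr hq
    · simpa using Or.inr hp
    · have := PCDeriv.lin 1 1 hp hq (by
        simpa using (MvPolynomial.totalDegree_add p q).trans
          (max_le hp.totalDegree_le hq.totalDegree_le))
      exact Or.inr (by simpa using this)
  smul_mem' := by
    rintro c p (rfl | hp)
    · simp
    · have := PCDeriv.lin c 0 hp hp (by
        simpa using (MvPolynomial.totalDegree_smul_le c p).trans hp.totalDegree_le)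
      exact Or.inr (by simpa using this)

lemma mul_X_mem_pcSubmodule {p : MvPolynomial V F2} (hp : p ∈ pcSubmodule Ax d) (v : V)
    (hd : p.totalDegree + 1 ≤ d) : p * MvPolynomial.X v ∈ pcSubmodule Ax d := by
  rcases hp with rfl | hp
  · simp
  · rw [mul_comm]
    refine Or.inr (PCDeriv.mul v hp ((MvPolynomial.totalDegree_mul _ _).trans ?_))
    simpa [add_comm] using hd

lemma mul_monomial_mem_pcSubmodule (m : V →₀ ℕ) {p : MvPolynomial V F2}
    (hp : p ∈ pcSubmodule Ax d) (hd : p.totalDegree + (m.sum fun _ e => e) ≤ d) :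
    p * MvPolynomial.monomial m 1 ∈ pcSubmodule Ax d := by
  induction m using Finsupp.induction_linear generalizing p with
  | zero => simpa using hp
  | add m₁ m₂ h₁ h₂ =>
    rw [Finsupp.sum_add_index' (by simp) (by simp)] at hd
    have : (MvPolynomial.monomial (m₁ + m₂) 1 : MvPolynomial V F2) =
        MvPolynomial.monomial m₁ 1 * MvPolynomial.monomial m₂ 1 := by
      simp [MvPolynomial.monomial_mul]
    rw [this, ← mul_assoc]
    refine h₂ (h₁ hp (by omega)) ?_
    have h := MvPolynomial.totalDegree_mul p (MvPolynomial.monomial m₁ 1)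
    have h' := MvPolynomial.totalDegree_monomial_le m₁ (1 : F2)
    change _ ≤ m₁.sum fun _ e => e at h'
    omega
  | single v n =>
    rw [Finsupp.sum_single_index rfl] at hd
    rw [← MvPolynomial.X_pow_eq_monomial]
    induction n with
    | zero => simpa using hp
    | succ n ih =>
      rw [pow_succ, ← mul_assoc]
      refine mul_X_mem_pcSubmodule (ih (by omega)) v ?_
      have h := MvPolynomial.totalDegree_mul p (MvPolynomial.X v ^ n)
      rw [MvPolynomial.totalDegree_X_pow] at h
      omega

lemma mul_mem_pcSubmodule {p : MvPolynomial V F2} (hp : p ∈ pcSubmodule Ax d)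
    (q : MvPolynomial V F2) (hd : p.totalDegree + q.totalDegree ≤ d) :
    p * q ∈ pcSubmodule Ax d := by
  rw [← MvPolynomial.support_sum_monomial_coeff q, Finset.mul_sum]
  refine Submodule.sum_mem _ fun m hm => ?_
  have h : (MvPolynomial.monomial m (q.coeff m) : MvPolynomial V F2) =
      q.coeff m • MvPolynomial.monomial m 1 := by
    rw [MvPolynomial.smul_monomial, smul_eq_mul, mul_one]
  rw [h, mul_smul_comm]
  refine Submodule.smul_mem _ _ (mul_monomial_mem_pcSubmodule m hp ?_)
  have := MvPolynomial.le_totalDegree hm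
  omega

/-- A polynomial of degree at most `d` that vanishes on the Boolean cube is derivable from the
Boolean axioms in degree `d`. -/
lemma mem_pcSubmodule_of_eval_eq_zero [Finite V] {p : MvPolynomial V F2} (hd : p.totalDegree ≤ d)
    (h : ∀ σ, MvPolynomial.eval σ p = 0) : p ∈ pcSubmodule Ax d := by
  obtain ⟨g, hg, hp⟩ :=
    MvPolynomial.combinatorial_nullstellensatz_exists_linearCombination
      (fun _ : V => (Finset.univ : Finset F2)) (fun _ => Finset.univ_nonempty) p (fun σ _ => h σ)
  have hprod (v : V) : ∏ s : F2, (MvPolynomial.X v - MvPolynomial.C s : MvPolynomial V F2) =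
      MvPolynomial.X v ^ 2 - MvPolynomial.X v := by
    have : (Finset.univ : Finset F2) = {0, 1} := by decide
    rw [this, Finset.prod_pair (by decide)]
    simp only [map_zero, map_one]
    ring
  simp only [hprod] at hg hp
  rw [hp, Finsupp.linearCombination_apply, Finsupp.sum]
  refine Submodule.sum_mem _ fun v hv => ?_
  rw [smul_eq_mul, mul_comm]
  have hg0 : g v ≠ 0 := Finsupp.mem_support_iff.mp hv
  have hX0 : (MvPolynomial.X v ^ 2 - MvPolynomial.X v : MvPolynomial V F2) ≠ 0 := by
    rw [← hprod]
    exact Finset.prod_ne_zero_iff.mpr fun s _ h0 => by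
      have := congrArg (MvPolynomial.eval fun _ => s + 1) h0
      simp at this
  have hdeg := (hg v).trans hd
  rw [MvPolynomial.totalDegree_mul_of_isDomain hX0 hg0] at hdeg
  exact mul_mem_pcSubmodule (Or.inr (PCDeriv.boolAx v (by omega))) _ hdeg

/-- The indicator polynomial `f + a + 1` of the equation `f = a`. -/
noncomputable def litPoly [Fintype V] (l : LinLit V) : MvPolynomial V F2 :=
  ∑ v, MvPolynomial.C (l.1 v) * MvPolynomial.X v + MvPolynomial.C (l.2 + 1)

lemma eval_litPoly [Fintype V] (σ : V → F2) (l : LinLit V) :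
    MvPolynomial.eval σ (litPoly l) = evalForm l.1 σ + l.2 + 1 := by
  simp [litPoly, evalForm, add_assoc]

lemma totalDegree_litPoly_le [Fintype V] (l : LinLit V) : (litPoly l).totalDegree ≤ 1 := by
  refine (MvPolynomial.totalDegree_add _ _).trans (max_le ?_ (by rw [MvPolynomial.totalDegree_C]; omega))
  refine MvPolynomial.totalDegree_finsetSum_le fun v _ => ?_
  refine (MvPolynomial.totalDegree_mul _ _).trans ?_
  simp

/-- The indicator polynomial of a system of equations `c D`, one for each `D ∈ S`. -/
noncomputable def choicePoly [Fintype V] (c : LinClause V → LinLit V) (S : Config V) : MvPolynomial V F2 :=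
  ∏ D ∈ S, litPoly (c D)

lemma totalDegree_choicePoly_le [Fintype V] (c : LinClause V → LinLit V) (S : Config V) :
    (choicePoly c S).totalDegree ≤ S.card := by
  refine (MvPolynomial.totalDegree_finsetProd _ _).trans ?_
  simpa using Finset.sum_le_card_nsmul S _ 1 fun D _ => totalDegree_litPoly_le (c D)

lemma eval_litPoly_eq_ite [Fintype V] (σ : V → F2) (l : LinLit V) [Decidable (LitSat σ l)] :
    MvPolynomial.eval σ (litPoly l) = if LitSat σ l then 1 else 0 := by
  rw [eval_litPoly]
  split_ifs with h
  · rw [LitSat] at h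
    rw [h, CharTwo.add_self_eq_zero, zero_add]
  · rw [LitSat] at h
    generalize evalForm l.1 σ = a at *
    generalize l.2 = b at *
    revert a b; decide

lemma eval_choicePoly_ne_zero [Fintype V] (c : LinClause V → LinLit V) (S : Config V) (σ : V → F2) :
    MvPolynomial.eval σ (choicePoly c S) ≠ 0 ↔ ∀ D ∈ S, LitSat σ (c D) := by
  classical
  simp [choicePoly, map_prod, Finset.prod_eq_zero_iff, eval_litPoly_eq_ite]

variable [Fintype V]

/-- If an affine subspace `A` of `F2^V` is covered by the equations in `C`, then on `A` some
subset of the indicators of these equations sums to `1`. -/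
lemma exists_subset_sum_eq_one (C : LinClause V) (A : Set (V → F2))
    (hA : ∀ x ∈ A, ∀ y ∈ A, ∀ z ∈ A, x + y + z ∈ A) (hC : ∀ σ ∈ A, ClauseSat σ C) :
    ∃ J ⊆ C, ∀ σ ∈ A, ∑ l ∈ J, (evalForm l.1 σ + l.2 + 1) = 1 := by
  have hF (a : F2) : a = 0 ∨ a = 1 := by revert a; decide
  have hsum (f : LinForm V) (x y z : V → F2) :
      evalForm f (x + y + z) = evalForm f x + evalForm f y + evalForm f z := by
    simp [evalForm, mul_add, Finset.sum_add_distrib]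
  induction C using Finset.induction_on generalizing A with
  | empty =>
    refine ⟨∅, subset_rfl, fun σ hσ => ?_⟩
    obtain ⟨l, hl, _⟩ := hC σ hσ
    simp at hl
  | insert l C hl ih =>
    have hone (σ) (h : LitSat σ l) : evalForm l.1 σ + l.2 + 1 = 1 := by
      rw [LitSat] at h
      rw [h, CharTwo.add_self_eq_zero, zero_add]
    have hzero (σ) (h : ¬ LitSat σ l) : evalForm l.1 σ + l.2 + 1 = 0 := by
      rw [LitSat] at h
      clear hone
      generalize evalForm l.1 σ = a at *
      generalize l.2 = b at *
      revert a b; decide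
    obtain ⟨J, hJC, hJ⟩ := ih {σ ∈ A | ¬ LitSat σ l}
      (by
        rintro x ⟨hx, hx'⟩ y ⟨hy, hy'⟩ z ⟨hz, hz'⟩
        refine ⟨hA x hx y hy z hz, ?_⟩
        have h₁ := hzero x hx'
        have h₂ := hzero y hy'
        have h₃ := hzero z hz'
        simp only [LitSat, hsum]
        clear hone hzero
        generalize evalForm l.1 x = a at *
        generalize evalForm l.1 y = b at *
        generalize evalForm l.1 z = c at *
        generalize l.2 = e at *
        revert a b c e; decide)
      (by
        rintro σ ⟨hσ, hσ'⟩
        obtain ⟨m, hm, hm'⟩ := hC σ hσ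
        rcases Finset.mem_insert.mp hm with rfl | hm
        · exact absurd hm' hσ'
        · exact ⟨m, hm, hm'⟩)
    by_cases hz : ∃ z ∈ A, ¬ LitSat z l
    · obtain ⟨z, hzA, hz⟩ := hz
      have hlJ : l ∉ J := fun h => hl (hJC h)
      have hconst : ∀ x ∈ A, LitSat x l → ∀ y ∈ A, LitSat y l →
          ∑ m ∈ J, (evalForm m.1 x + m.2 + 1) = ∑ m ∈ J, (evalForm m.1 y + m.2 + 1) := by
        intro x hx hxl y hy hyl
        have h₁ := hJ z ⟨hzA, hz⟩
        have h₂ := hJ (x + y + z) ⟨hA x hx y hy z hzA, by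
          have := hzero z hz
          rw [LitSat] at hxl hyl ⊢
          rwa [hsum, hxl, hyl, CharTwo.add_self_eq_zero, zero_add]⟩
        have h₃ : ∑ m ∈ J, (evalForm m.1 (x + y + z) + m.2 + 1) =
            ∑ m ∈ J, (evalForm m.1 x + m.2 + 1) + ∑ m ∈ J, (evalForm m.1 y + m.2 + 1) +
              ∑ m ∈ J, (evalForm m.1 z + m.2 + 1) := by
          rw [← Finset.sum_add_distrib, ← Finset.sum_add_distrib]
          refine Finset.sum_congr rfl fun m _ => ?_
          rw [hsum]
          generalize evalForm m.1 x = a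
          generalize evalForm m.1 y = b
          generalize evalForm m.1 z = c
          generalize m.2 = e
          revert a b c e; decide
        rw [h₁, h₂] at h₃
        exact CharTwo.add_eq_zero.mp (by simpa using h₃.symm)
      by_cases hx : ∃ x ∈ A, LitSat x l ∧ ∑ m ∈ J, (evalForm m.1 x + m.2 + 1) = 0
      · obtain ⟨x, hxA, hxl, hx0⟩ := hx
        refine ⟨insert l J, Finset.insert_subset_insert _ hJC, fun σ hσ => ?_⟩
        rw [Finset.sum_insert hlJ]
        by_cases hσl : LitSat σ l
        · rw [hone σ hσl, hconst σ hσ hσl x hxA hxl, hx0, add_zero]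
        · rw [hzero σ hσl, hJ σ ⟨hσ, hσl⟩, zero_add]
      · refine ⟨J, hJC.trans (Finset.subset_insert _ _), fun σ hσ => ?_⟩
        by_cases hσl : LitSat σ l
        · exact (hF _).resolve_left fun h => hx ⟨σ, hσ, hσl, h⟩
        · exact hJ σ ⟨hσ, hσl⟩
    · push Not at hz
      exact ⟨{l}, by simp, fun σ hσ => by simpa using hone σ (hz σ hσ)⟩

/-- One equation can be chosen from each clause of `S` so that the resulting linear system is not
refuted by degree-`d` Polynomial Calculus. -/
def Consistent (Ax : Set (MvPolynomial V F2)) (d : ℕ) (S : Config V) : Prop :=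
  ∃ c : LinClause V → LinLit V, (∀ D ∈ S, c D ∈ D) ∧ choicePoly c S ∉ pcSubmodule Ax d

lemma Consistent.insert_of_exists {c : LinClause V → LinLit V} {S : Config V} {C : LinClause V}
    (hc : ∀ D ∈ S, c D ∈ D) (hCS : C ∉ S)
    (h : ∃ l ∈ C, choicePoly c S * litPoly l ∉ pcSubmodule Ax d) : Consistent Ax d (insert C S) := by
  obtain ⟨l, hl, h⟩ := h
  have hne (D) (hD : D ∈ S) : D ≠ C := fun h => hCS (h ▸ hD)
  refine ⟨Function.update c C l, fun D hD => ?_, ?_⟩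
  · rcases Finset.mem_insert.mp hD with rfl | hD
    · simpa using hl
    · simpa [Function.update_of_ne (hne D hD)] using hc D hD
  · have hprod : choicePoly (Function.update c C l) S = choicePoly c S :=
      Finset.prod_congr rfl fun D hD => by rw [Function.update_of_ne (hne D hD)]
    have : choicePoly (Function.update c C l) (insert C S) =
        litPoly (Function.update c C l C) * choicePoly (Function.update c C l) S :=
      Finset.prod_insert hCS
    rwa [this, hprod, Function.update_self, mul_comm]

lemma Consistent.erase {S : Config V} (h : Consistent Ax d S) (hd : S.card ≤ d) {C : LinClause V}
    (hC : C ∈ S) : Consistent Ax d (S.erase C) := by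
  obtain ⟨c, hc, h⟩ := h
  refine ⟨c, fun D hD => hc D (Finset.mem_of_mem_erase hD), fun hmem => h ?_⟩
  have := mul_mem_pcSubmodule hmem (litPoly (c C)) (by
    have h₁ := totalDegree_choicePoly_le c (S.erase C)
    have h₂ := totalDegree_litPoly_le (c C)
    have h₃ := Finset.card_erase_add_one hC
    omega)
  rwa [choicePoly, Finset.prod_erase_mul _ _ hC] at this

lemma Consistent.insert_of_entails {S : Config V} (h : Consistent Ax d S) {C : LinClause V}
    (hCS : C ∉ S) (hd : S.card + 1 ≤ d)
    (hC : ∀ σ, (∀ D ∈ S, ClauseSat σ D) → ClauseSat σ C) : Consistent Ax d (insert C S) := by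
  obtain ⟨c, hc, h⟩ := h
  refine Consistent.insert_of_exists hc hCS ?_
  by_contra! hall
  obtain ⟨J, hJC, hJ⟩ := exists_subset_sum_eq_one C {σ | ∀ D ∈ S, LitSat σ (c D)}
    (fun x hx y hy z hz D hD => by
      have h₁ := hx D hD
      have h₂ := hy D hD
      have h₃ := hz D hD
      simp only [LitSat, evalForm] at *
      simp only [Pi.add_apply, mul_add, Finset.sum_add_distrib, h₁, h₂, h₃,
        CharTwo.add_self_eq_zero, zero_add])
    (fun σ hσ => hC σ fun D hD => ⟨c D, hc D hD, hσ D hD⟩)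
  have hdeg (l : LinLit V) : (choicePoly c S * litPoly l).totalDegree ≤ d := by
    have h₁ := totalDegree_choicePoly_le c S
    have h₂ := totalDegree_litPoly_le l
    have h₃ := MvPolynomial.totalDegree_mul (choicePoly c S) (litPoly l)
    omega
  have hsum : ∑ l ∈ J, choicePoly c S * litPoly l ∈ pcSubmodule Ax d :=
    Submodule.sum_mem _ fun l hl => hall l (hJC hl)
  have hdiff : choicePoly c S - ∑ l ∈ J, choicePoly c S * litPoly l ∈ pcSubmodule Ax d := by
    refine mem_pcSubmodule_of_eval_eq_zero ?_ fun σ => ?_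
    · refine (MvPolynomial.totalDegree_sub _ _).trans (max_le ?_ ?_)
      · have := totalDegree_choicePoly_le c S
        omega
      · exact MvPolynomial.totalDegree_finsetSum_le fun l _ => hdeg l
    · by_cases h0 : MvPolynomial.eval σ (choicePoly c S) = 0
      · simp [h0]
      · have := hJ σ ((eval_choicePoly_ne_zero c S σ).mp h0)
        simp only [map_sub, map_sum, map_mul, ← Finset.mul_sum, eval_litPoly, this, mul_one,
          sub_self]
  exact h (by simpa using Submodule.add_mem _ hdiff hsum)

variable [DecidableEq V]

lemma one_sub_litPoly (l : V × Bool) :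
    1 - litPoly (if l.2 then posLit l.1 else negLit l.1) =
      (if l.2 then 1 - MvPolynomial.X l.1 else MvPolynomial.X l.1 : MvPolynomial V F2) := by
  have h (v : V) : ∑ u, MvPolynomial.C ((Pi.single v (1 : F2) : V → F2) u) * MvPolynomial.X u
      = (MvPolynomial.X v : MvPolynomial V F2) := by
    rw [Finset.sum_eq_single v] <;> simp +contextual
  have h2 : (1 + 1 : F2) = 0 := by decide
  rcases l with ⟨v, _ | _⟩
  · simp [litPoly, negLit, h, CharTwo.neg_eq]
  · simp only [litPoly, posLit, h, h2, map_zero, add_zero, if_true]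

lemma Consistent.insert_of_download {φ : BoolCNF V} {r : ℕ} {S : Config V}
    (h : Consistent (arithSet φ) d S) {C : BoolClause V} (hC : C ∈ φ) (hr : C.card ≤ r)
    (hCS : toLinClause C ∉ S) (hd : S.card + 1 + r ≤ d) :
    Consistent (arithSet φ) d (insert (toLinClause C) S) := by
  obtain ⟨c, hc, h⟩ := h
  refine Consistent.insert_of_exists hc hCS ?_
  by_contra! hall
  have hP := totalDegree_choicePoly_le c S
  have hfac (l : V × Bool) : (if l.2 then 1 - MvPolynomial.X l.1 else MvPolynomial.X l.1 :
      MvPolynomial V F2).totalDegree ≤ 1 := by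
    rw [← one_sub_litPoly]
    exact (MvPolynomial.totalDegree_sub _ _).trans (max_le (by simp) (totalDegree_litPoly_le _))
  have hdeg (T : BoolClause V) : (clausePoly T).totalDegree ≤ T.card := by
    refine (MvPolynomial.totalDegree_finsetProd _ _).trans ?_
    simpa using Finset.sum_le_card_nsmul T _ 1 fun l _ => hfac l
  have key (T : BoolClause V) (hT : T ⊆ C) :
      choicePoly c S - choicePoly c S * clausePoly T ∈ pcSubmodule (arithSet φ) d := by
    induction T using Finset.induction_on with
    | empty => simp [clausePoly]
    | insert l T hl ih =>
      have hTC := (Finset.subset_insert l T).trans hT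
      have hmem := mul_mem_pcSubmodule
        (hall _ (Finset.mem_image_of_mem _ (hT (Finset.mem_insert_self l T)))) (clausePoly T) (by
          have h₁ := MvPolynomial.totalDegree_mul (choicePoly c S)
            (litPoly (if l.2 then posLit l.1 else negLit l.1))
          have h₂ := totalDegree_litPoly_le (if l.2 then posLit l.1 else negLit l.1)
          have h₃ := hdeg T
          have h₄ := Finset.card_le_card hTC
          omega)
      have := Submodule.add_mem _ (ih hTC) hmem
      rw [clausePoly, Finset.prod_insert hl, ← one_sub_litPoly]
      convert this using 1
      rw [clausePoly]
      ring
  have hCmem : clausePoly C ∈ pcSubmodule (arithSet φ) d :=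
    Or.inr (PCDeriv.ax ⟨C, hC, rfl⟩ (by have := hdeg C; omega))
  have hCmul := mul_mem_pcSubmodule hCmem (choicePoly c S) (by have := hdeg C; omega)
  rw [mul_comm] at hCmul
  exact h (by simpa using Submodule.add_mem _ (key C subset_rfl) hCmul)

lemma InferSem.entails {S : Config V} {C : LinClause V} (h : InferSem S C) (σ : V → F2)
    (hS : ∀ D ∈ S, ClauseSat σ D) : ClauseSat σ C := by
  rcases h with ⟨f, A, B, hA, hB, rfl⟩ | ⟨D, hD, h⟩
  · obtain ⟨l, hl, hlσ⟩ := hS _ hA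
    obtain ⟨m, hm, hmσ⟩ := hS _ hB
    rcases Finset.mem_insert.mp hl with rfl | hl
    · rcases Finset.mem_insert.mp hm with rfl | hm
      · exact absurd (hlσ.symm.trans hmσ) (by simp)
      · exact ⟨m, Finset.mem_union_right _ hm, hmσ⟩
    · exact ⟨l, Finset.mem_union_left _ hl, hlσ⟩
  · exact h σ (hS D hD)

lemma Consistent.of_configStep {φ : BoolCNF V} {r s : ℕ} (hr : ∀ C ∈ φ, C.card ≤ r)
    {S T : Config V} (h : Consistent (arithSet φ) (s + r) S) (hS : S.card ≤ s) (hT : T.card ≤ s)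
    (hstep : ConfigStep (toLinCNF φ) InferSem S T) : Consistent (arithSet φ) (s + r) T := by
  cases hstep with
  | @download D hD =>
    by_cases hDS : D ∈ S
    · rwa [Finset.insert_eq_self.mpr hDS]
    · obtain ⟨C, hC, rfl⟩ := hD
      rw [Finset.card_insert_of_notMem hDS] at hT
      exact h.insert_of_download hC (hr C hC) hDS (by omega)
  | erase hC => exact h.erase (by omega) hC
  | @infer D hD =>
    by_cases hDS : D ∈ S
    · rwa [Finset.insert_eq_self.mpr hDS]
    · rw [Finset.card_insert_of_notMem hDS] at hT
      exact h.insert_of_entails hDS (by omega) hD.entails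

lemma Consistent.of_isChain {φ : BoolCNF V} {r s : ℕ} (hr : ∀ C ∈ φ, C.card ≤ r)
    {π : List (Config V)} {S : Config V} (h : Consistent (arithSet φ) (s + r) S)
    (hchain : List.IsChain (ConfigStep (toLinCNF φ) InferSem) (S :: π))
    (hs : ∀ T ∈ S :: π, T.card ≤ s) : ∀ T ∈ S :: π, Consistent (arithSet φ) (s + r) T := by
  induction π generalizing S with
  | nil => simpa using h
  | cons U π ih =>
    rw [List.isChain_cons_cons] at hchain
    have hU := h.of_configStep hr (hs S (by simp)) (hs U (by simp)) hchain.1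
    have := ih hU hchain.2 fun T hT => hs T (List.mem_cons_of_mem _ hT)
    intro T hT
    rcases List.mem_cons.mp hT with rfl | hT
    · exact h
    · exact this T hT

/-- A refutation of space `s` yields a Polynomial Calculus refutation of degree `s + r`. -/
theorem pcDeriv_one_of_isConfigRefutation {φ : BoolCNF V} {r : ℕ} (hr : ∀ C ∈ φ, C.card ≤ r)
    {π : List (Config V)} (hπ : IsConfigRefutation (toLinCNF φ) InferSem π) :
    PCDeriv (arithSet φ) (spaceOf π + r) 1 := by
  by_contra hone
  obtain ⟨hhead, hchain, S, hlast, hempty⟩ := hπ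
  obtain ⟨π, rfl⟩ : ∃ l, π = ∅ :: l := by
    cases π with
    | nil => simp at hhead
    | cons T l => exact ⟨l, by simpa using hhead⟩
  have h0 : Consistent (arithSet φ) (spaceOf (∅ :: π) + r) (∅ : Config V) := by
    refine ⟨fun _ => 0, by simp, ?_⟩
    rintro (h | h)
    · simp [choicePoly] at h
    · exact hone (by simpa [choicePoly] using h)
  obtain ⟨c, hc, -⟩ := h0.of_isChain hr hchain (fun T hT => card_le_spaceOf hT) S
    (List.mem_of_getLast? hlast)
  simpa using hc ∅ hempty

/-- The clause stating that the assignment differs from `σ` somewhere on `T`. -/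
def disagreeClause (σ : V → F2) (T : Finset V) : LinClause V :=
  T.image fun v => (Pi.single v 1, σ v + 1)

lemma clauseSat_disagreeClause_univ {σ τ : V → F2} (h : τ ≠ σ) :
    ClauseSat τ (disagreeClause σ univ) := by
  obtain ⟨v, hv⟩ := Function.ne_iff.mp h
  refine ⟨_, Finset.mem_image_of_mem _ (Finset.mem_univ v), ?_⟩
  simp only [LitSat, evalForm, Pi.single_apply, ite_mul, one_mul, zero_mul, Finset.sum_ite_eq',
    Finset.mem_univ, if_true]
  generalize τ v = a at *
  generalize σ v = b at *
  revert a b; decide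

lemma insert_disagreeClause (σ : V → F2) {T : Finset V} {v : V} (hv : v ∉ T) (a : F2) :
    insert (Pi.single v 1, a) (disagreeClause σ T) =
      disagreeClause (Function.update σ v (a + 1)) (insert v T) := by
  have ha : a + 1 + 1 = a := by revert a; decide
  rw [disagreeClause, disagreeClause, Finset.image_insert, Function.update_self, ha]
  congr 1
  refine Finset.image_congr fun u hu => ?_
  have : u ≠ v := fun h => hv (h ▸ hu)
  simp [Function.update_of_ne this]

/-- A configuration closed under downloads and inferences contains the empty clause. -/
lemma empty_mem_of_closed {φ : LinCNF V} (hφ : Unsat φ) {S : Config V} (hdown : ∀ C ∈ φ, C ∈ S)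
    (hinf : ∀ C, InferSem S C → C ∈ S) : ∅ ∈ S := by
  have key (T : Finset V) : ∀ σ, disagreeClause σ Tᶜ ∈ S := by
    induction T using Finset.induction_on with
    | empty =>
      intro σ
      have : ∃ D ∈ φ, ¬ ClauseSat σ D := by
        by_contra! h
        exact hφ ⟨σ, h⟩
      obtain ⟨D, hD, hσ⟩ := this
      refine hinf _ (Or.inr ⟨D, hdown D hD, fun τ hτ => ?_⟩)
      rw [Finset.compl_empty]
      exact clauseSat_disagreeClause_univ fun h => hσ (h ▸ hτ)
    | insert v T hv ih =>
      intro σ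
      have hins : insert v (insert v T)ᶜ = Tᶜ := by
        ext u
        by_cases h : u = v <;> simp [h, hv]
      refine hinf _ (Or.inl ⟨Pi.single v 1, _, _, ?_, ?_, (Finset.union_self _).symm⟩) <;>
      · rw [insert_disagreeClause σ (by simp), hins]
        exact ih _
  simpa [disagreeClause] using key univ 0

/-- Completeness of configuration-style Res(⊕). -/
theorem exists_isConfigRefutation {φ : LinCNF V} (hφ : Unsat φ) :
    ∃ π, IsConfigRefutation φ InferSem π := by
  obtain ⟨S, hS, hmax⟩ := Set.Finite.exists_maximalFor (Finset.card : Config V → ℕ)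
    {S | Relation.ReflTransGen (ConfigStep φ InferSem) ∅ S} (Set.toFinite _) ⟨∅, .refl⟩
  have hmem (C : LinClause V) (h : ConfigStep φ InferSem S (insert C S)) : C ∈ S := by
    by_contra hC
    have := hmax (Relation.ReflTransGen.tail hS h) (Finset.card_le_card (Finset.subset_insert _ _))
    rw [Finset.card_insert_of_notMem hC] at this
    omega
  have hempty := empty_mem_of_closed hφ (fun C hC => hmem C (.download hC))
    (fun C hC => hmem C (.infer hC))
  obtain ⟨l, hl, hlast⟩ := List.exists_isChain_cons_of_relationReflTransGen hS
  exact ⟨∅ :: l, rfl, hl, S, by rw [List.getLast?_eq_getLast_of_ne_nil (by simp), hlast], hempty⟩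

end Refutation

/-- For every unsatisfiable `r`-CNF formula `φ`,
`Space(φ) ≥ Deg(φ) − r − 1`, where `Space` is the Res(⊕) clause space of `φ` and `Deg` is
the minimum degree of a `PC_{F2}` refutation of the arithmetization of `φ`. -/
theorem space_ge_deg_sub
    {V : Type} [Fintype V] [DecidableEq V] (φ : BoolCNF V) (r : ℕ)
    (hunsat : Unsat (toLinCNF φ)) (hr : ∀ C ∈ φ, C.card ≤ r) :
    DegOfCNF φ - r - 1 ≤ SpaceOfCNF (toLinCNF φ) := by
  obtain ⟨π₀, hπ₀⟩ := exists_isConfigRefutation hunsat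
  obtain ⟨π, hπ, hspace⟩ :=
    Nat.sInf_mem (s := {s | ∃ π, IsConfigRefutation (toLinCNF φ) InferSem π ∧ spaceOf π = s})
      ⟨_, π₀, hπ₀, rfl⟩
  have hdeg : DegOfCNF φ ≤ spaceOf π + r := Nat.sInf_le (pcDeriv_one_of_isConfigRefutation hr hπ)
  rw [SpaceOfCNF, ← hspace]
  omega
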